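/- Let (c, ρ, θ, u) be a smooth classical solution of the mesoscopic two-phase Navier–Stokes system on [0,T], spatially 1-periodic, with 0 ≤ c ≤ 1, and suppose there exist constants 0 < ρ̲ ≤ ρ̄ and 0 < θ̲ ≤ θ̄ with ρ̲ ≤ ρ ≤ ρ̄ and θ̲ ≤ θ ≤ θ̄ on [0,T]×ℝ, and that ∫₀¹σ(0,x)²dx < ∞ where σ = μ(c)∂ₓu − (γ(c)−1)ρθ. Then there exist constants C₈, C₉ > 0, depending only on μ_±, γ_±, c_{v,±}, ρ̲, ρ̄, θ̄, T, the initial total mass and total energy, and ∫₀¹σ(0,x)²dx, such that for every t ∈ [0,T]: ∫₀¹ (∂ₓu(t,x))² dx ≤ C₈ and ∫₀ᵀ ‖∂ₓu(t,·)‖_{L^∞(0,1)}² dt ≤ C₉; that is, ∂ₓu ∈ L^∞(0,T; L²) ∩ L²(0,T; L^∞). -/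

import Mathlib

open Set Function MeasureTheory intervalIntegral

/-- Partial derivative in time of a function of `(t, x)`. -/
noncomputable def pdt (f : ℝ → ℝ → ℝ) (t x : ℝ) : ℝ := deriv (fun s => f s x) t

/-- Partial derivative in space of a function of `(t, x)`. -/
noncomputable def pdx (f : ℝ → ℝ → ℝ) (t x : ℝ) : ℝ := deriv (fun y => f t y) x

/-- Affine interpolation of a coefficient between the two phases:
`aff a b c = c·a + (1−c)·b` (so `μ(c) = aff μ₊ μ₋ c`, etc.). -/
def affc (a b s : ℝ) : ℝ := s * a + (1 - s) * b

/-- Cauchy stress `σ = μ(c)∂ₓu − (γ(c)−1)ρθ` of the mesoscopic two-phase model. -/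
noncomputable def sigm (μp μm γp γm : ℝ) (c ρ θ u : ℝ → ℝ → ℝ) (t x : ℝ) : ℝ :=
  affc μp μm (c t x) * pdx u t x - (affc γp γm (c t x) - 1) * ρ t x * θ t x

/-- Specific total energy `E = u²/2 + c_v(c)θ`. -/
noncomputable def Etot (kp km : ℝ) (c θ u : ℝ → ℝ → ℝ) (t x : ℝ) : ℝ :=
  u t x ^ 2 / 2 + affc kp km (c t x) * θ t x

/-- Admissible constants: `μ_± > 0`, `γ_± > 1`, `c_{v,±} > 0`. -/
def GoodConsts (μp μm γp γm kp km : ℝ) : Prop :=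
  0 < μp ∧ 0 < μm ∧ 1 < γp ∧ 1 < γm ∧ 0 < kp ∧ 0 < km

/-- The mesoscopic two-phase Navier–Stokes system on the one-dimensional torus:
spatial 1-periodicity together with the transport, mass, momentum and total
energy equations, satisfied pointwise on `[0,T] × ℝ`. -/
def MesoEqns (μp μm γp γm kp km T : ℝ) (c ρ θ u : ℝ → ℝ → ℝ) : Prop :=
  (∀ t x : ℝ, c t (x + 1) = c t x) ∧ (∀ t x : ℝ, ρ t (x + 1) = ρ t x) ∧
  (∀ t x : ℝ, θ t (x + 1) = θ t x) ∧ (∀ t x : ℝ, u t (x + 1) = u t x) ∧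
  (∀ t ∈ Icc (0:ℝ) T, ∀ x : ℝ, pdt c t x + u t x * pdx c t x = 0) ∧
  (∀ t ∈ Icc (0:ℝ) T, ∀ x : ℝ,
    pdt ρ t x + pdx (fun s y => ρ s y * u s y) t x = 0) ∧
  (∀ t ∈ Icc (0:ℝ) T, ∀ x : ℝ,
    pdt (fun s y => ρ s y * u s y) t x + pdx (fun s y => ρ s y * u s y ^ 2) t x
      = pdx (sigm μp μm γp γm c ρ θ u) t x) ∧
  (∀ t ∈ Icc (0:ℝ) T, ∀ x : ℝ,
    pdt (fun s y => ρ s y * Etot kp km c θ u s y) t x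
      + pdx (fun s y => ρ s y * Etot kp km c θ u s y * u s y) t x
      = pdx (fun s y => sigm μp μm γp γm c ρ θ u s y * u s y) t x)

theorem aux_hx {f : ℝ → ℝ → ℝ} {t x : ℝ} (h : ContDiffAt ℝ 1 (uncurry f) (t, x)) :
    HasDerivAt (fun y => f t y) (fderiv ℝ (uncurry f) (t, x) (0, 1)) x := by
  have h1 : HasFDerivAt (uncurry f) (fderiv ℝ (uncurry f) (t, x)) (t, x) :=
    (h.differentiableAt (by norm_num)).hasFDerivAt
  have h2 : HasDerivAt (fun y : ℝ => ((t, y) : ℝ × ℝ)) (0, 1) x :=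
    (hasDerivAt_const x t).prodMk (hasDerivAt_id x)
  exact h1.comp_hasDerivAt x h2

theorem aux_ht {f : ℝ → ℝ → ℝ} {t x : ℝ} (h : ContDiffAt ℝ 1 (uncurry f) (t, x)) :
    HasDerivAt (fun s => f s x) (fderiv ℝ (uncurry f) (t, x) (1, 0)) t := by
  have h1 : HasFDerivAt (uncurry f) (fderiv ℝ (uncurry f) (t, x)) (t, x) :=
    (h.differentiableAt (by norm_num)).hasFDerivAt
  have h2 : HasDerivAt (fun s : ℝ => ((s, x) : ℝ × ℝ)) (1, 0) t :=
    (hasDerivAt_id t).prodMk (hasDerivAt_const t x)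
  exact h1.comp_hasDerivAt t h2

/-- Smoothness, jointly in `(t, x)`. -/
def Smo (f : ℝ → ℝ → ℝ) : Prop := ContDiff ℝ (⊤ : ℕ∞) (uncurry f)

theorem Smo.c1 {f : ℝ → ℝ → ℝ} (h : Smo f) : ContDiff ℝ 1 (uncurry f) :=
  h.of_le (by exact_mod_cast le_top)

theorem Smo.pdx_eq {f : ℝ → ℝ → ℝ} (h : Smo f) (t x : ℝ) :
    pdx f t x = fderiv ℝ (uncurry f) (t, x) (0, 1) := (aux_hx h.c1.contDiffAt).deriv

theorem Smo.pdt_eq {f : ℝ → ℝ → ℝ} (h : Smo f) (t x : ℝ) :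
    pdt f t x = fderiv ℝ (uncurry f) (t, x) (1, 0) := (aux_ht h.c1.contDiffAt).deriv

theorem Smo.hx {f : ℝ → ℝ → ℝ} (h : Smo f) (t x : ℝ) :
    HasDerivAt (fun y => f t y) (pdx f t x) x := by
  rw [h.pdx_eq]; exact aux_hx h.c1.contDiffAt

theorem Smo.ht {f : ℝ → ℝ → ℝ} (h : Smo f) (t x : ℝ) :
    HasDerivAt (fun s => f s x) (pdt f t x) t := by
  rw [h.pdt_eq]; exact aux_ht h.c1.contDiffAt

theorem Smo.fd {f : ℝ → ℝ → ℝ} (h : Smo f) (v : ℝ × ℝ) :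
    ContDiff ℝ (⊤ : ℕ∞) (fun p : ℝ × ℝ => fderiv ℝ (uncurry f) p v) := by
  have : ContDiff ℝ (⊤ : ℕ∞) (fderiv ℝ (uncurry f)) := h.fderiv_right (by simp)
  exact this.clm_apply contDiff_const

theorem Smo.px {f : ℝ → ℝ → ℝ} (h : Smo f) : Smo (pdx f) := by
  have := h.fd (0, 1)
  unfold Smo
  convert this using 1
  funext p
  exact h.pdx_eq p.1 p.2

theorem Smo.pt {f : ℝ → ℝ → ℝ} (h : Smo f) : Smo (pdt f) := by
  have := h.fd (1, 0)
  unfold Smo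
  convert this using 1
  funext p
  exact h.pdt_eq p.1 p.2

theorem Smo.swap {f : ℝ → ℝ → ℝ} (h : Smo f) (t x : ℝ) :
    pdt (pdx f) t x = pdx (pdt f) t x := by
  have hd : DifferentiableAt ℝ (fderiv ℝ (uncurry f)) (t, x) := by
    have : ContDiff ℝ (⊤ : ℕ∞) (fderiv ℝ (uncurry f)) := h.fderiv_right (by simp)
    exact (this.differentiable (by simp)) _
  have key : ∀ v : ℝ × ℝ, fderiv ℝ (fun p : ℝ × ℝ => fderiv ℝ (uncurry f) p v) (t, x)
      = (fderiv ℝ (fderiv ℝ (uncurry f)) (t, x)).flip v := by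
    intro v
    have := hd.hasFDerivAt.clm_apply (hasFDerivAt_const v (t, x))
    rw [this.fderiv]; ext <;> simp
  have e1 : uncurry (pdx f) = fun p : ℝ × ℝ => fderiv ℝ (uncurry f) p (0, 1) := by
    funext p; exact h.pdx_eq p.1 p.2
  have e2 : uncurry (pdt f) = fun p : ℝ × ℝ => fderiv ℝ (uncurry f) p (1, 0) := by
    funext p; exact h.pdt_eq p.1 p.2
  rw [h.px.pdt_eq, h.pt.pdx_eq, e1, e2, key, key]
  have hs : IsSymmSndFDerivAt ℝ (uncurry f) (t, x) :=
    ContDiffAt.isSymmSndFDerivAt (n := (⊤ : ℕ∞)) h.contDiffAt (by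
      simp only [minSmoothness_of_isRCLikeNormedField]
      exact WithTop.coe_le_coe.2 (le_top : (2:ℕ∞) ≤ ⊤))
  exact hs.eq _ _

theorem Smo.slice {f : ℝ → ℝ → ℝ} (h : Smo f) (t : ℝ) :
    ContDiff ℝ (⊤ : ℕ∞) (fun x => f t x) :=
  ContDiff.comp (g := uncurry f) h (contDiff_const.prodMk contDiff_id)

theorem Smo.cx {f : ℝ → ℝ → ℝ} (h : Smo f) (t : ℝ) : Continuous (fun x => f t x) :=
  (h.slice t).continuous

theorem param_deriv {F : ℝ → ℝ → ℝ} {t : ℝ}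
    (h : ∀ x ∈ Icc (0:ℝ) 1, ContDiffAt ℝ 1 (uncurry F) (t, x)) :
    HasDerivAt (fun s => ∫ x in (0:ℝ)..1, F s x) (∫ x in (0:ℝ)..1, pdt F t x) t := by
  set S : Set (ℝ × ℝ) := {p | ContDiffAt ℝ 1 (uncurry F) p} with hS
  have hSo : IsOpen S := by
    rw [isOpen_iff_mem_nhds]
    intro p hp
    exact ContDiffAt.eventually hp (by norm_num)
  obtain ⟨U, V, hU, hV, htU, hV1, hUV⟩ := generalized_tube_lemma (isCompact_singleton (x := t))
    (isCompact_Icc (a := (0:ℝ)) (b := 1)) hSo (by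
      rintro ⟨a, b⟩ ⟨ha, hb⟩
      simp only [mem_singleton_iff] at ha
      subst ha
      exact h b hb)
  obtain ⟨ε, hε, hball⟩ := Metric.nhds_basis_closedBall.mem_iff.1
    (hU.mem_nhds (htU (mem_singleton t)))
  have hsub : ∀ s ∈ Metric.closedBall t ε, ∀ x ∈ Icc (0:ℝ) 1,
      ContDiffAt ℝ 1 (uncurry F) (s, x) := fun s hs x hx => hUV ⟨hball hs, hV1 hx⟩
  have hcont : ContinuousOn (fun p : ℝ × ℝ => fderiv ℝ (uncurry F) p (1, 0))
      (Metric.closedBall t ε ×ˢ Icc (0:ℝ) 1) := by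
    rintro ⟨s, x⟩ ⟨hs, hx⟩
    have := (hsub s hs x hx).fderiv_right (m := 0) (by norm_num)
    exact (this.continuousAt.clm_apply continuousAt_const).continuousWithinAt
  obtain ⟨B, hB⟩ := ((isCompact_closedBall t ε).prod isCompact_Icc).exists_bound_of_continuousOn hcont
  have hcF : ∀ s ∈ Metric.closedBall t ε, ContinuousOn (F s) (Icc (0:ℝ) 1) := by
    intro s hs x hx
    exact (aux_hx (hsub s hs x hx)).continuousAt.continuousWithinAt
  have hmem := Metric.closedBall_mem_nhds t hε
  have ht0 : t ∈ Metric.closedBall t ε := Metric.mem_closedBall_self hε.le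
  have hI : uIoc (0:ℝ) 1 ⊆ Icc 0 1 := by
    rw [uIoc_of_le zero_le_one]; exact Ioc_subset_Icc_self
  have hcF' : ContinuousOn (fun x => fderiv ℝ (uncurry F) (t, x) (1, 0)) (Icc (0:ℝ) 1) := by
    refine hcont.comp (Continuous.continuousOn (by fun_prop)) ?_
    intro x hx; exact ⟨ht0, hx⟩
  have := (intervalIntegral.hasDerivAt_integral_of_dominated_loc_of_deriv_le (μ := volume)
    (F := F) (F' := fun s x => fderiv ℝ (uncurry F) (s, x) (1, 0)) (x₀ := t) (a := 0) (b := 1)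
    (bound := fun _ => B) hmem
    (by
      filter_upwards [hmem] with s hs
      exact ((hcF s hs).mono hI).aestronglyMeasurable measurableSet_uIoc)
    (ContinuousOn.intervalIntegrable (by rw [uIcc_of_le zero_le_one]; exact hcF t ht0))
    ((hcF'.mono hI).aestronglyMeasurable measurableSet_uIoc)
    (Filter.Eventually.of_forall fun x hx s hs => hB (s, x) ⟨hs, hI hx⟩)
    (by simp)
    (Filter.Eventually.of_forall fun x hx s hs => aux_ht (hsub s hs x (hI hx)))).2
  have heq : ∫ x in (0:ℝ)..1, pdt F t x
      = ∫ x in (0:ℝ)..1, fderiv ℝ (uncurry F) (t, x) (1, 0) := by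
    refine intervalIntegral.integral_congr fun x hx => ?_
    rw [uIcc_of_le zero_le_one] at hx
    exact (aux_ht (h x hx)).deriv
  rw [heq]
  exact this

theorem int_per {H : ℝ → ℝ} (hH : ContDiff ℝ 1 H) (hp : H 1 = H 0) :
    ∫ x in (0:ℝ)..1, deriv H x = 0 := by
  rw [intervalIntegral.integral_deriv_eq_sub (fun x _ => (hH.differentiable (by norm_num)) x)
    ((hH.continuous_deriv (by norm_num)).intervalIntegrable _ _), hp, sub_self]

theorem sobo {f : ℝ → ℝ} (hf : ContDiff ℝ 1 f) {x : ℝ} (hx : x ∈ Icc (0:ℝ) 1) :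
    f x ^ 2 ≤ 2 * (∫ y in (0:ℝ)..1, f y ^ 2) + 2 * (∫ y in (0:ℝ)..1, deriv f y ^ 2) := by
  have hc : Continuous f := hf.continuous
  have hc' : Continuous (deriv f) := hf.continuous_deriv (by norm_num)
  have hi1 : IntervalIntegrable (fun y => f y ^ 2) volume 0 1 :=
    (by fun_prop : Continuous fun y => f y ^ 2).intervalIntegrable _ _
  have hi2 : IntervalIntegrable (fun y => deriv f y ^ 2) volume 0 1 :=
    (by fun_prop : Continuous fun y => deriv f y ^ 2).intervalIntegrable _ _
  set A := ∫ y in (0:ℝ)..1, f y ^ 2 with hA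
  set W := ∫ y in (0:ℝ)..1, deriv f y ^ 2 with hW
  have hA0 : 0 ≤ A := intervalIntegral.integral_nonneg zero_le_one fun y _ => sq_nonneg _
  have hW0 : 0 ≤ W := intervalIntegral.integral_nonneg zero_le_one fun y _ => sq_nonneg _
  have key : ∀ z ∈ Icc (0:ℝ) 1, f x ^ 2 - (A + W) ≤ f z ^ 2 := by
    intro z hz
    have h1 : ∫ y in z..x, 2 * f y * deriv f y = f x ^ 2 - f z ^ 2 := by
      refine intervalIntegral.integral_eq_sub_of_hasDerivAt (f := fun y => f y ^ 2) ?_ ?_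
      · intro y _
        have := ((hf.differentiable (by norm_num)) y).hasDerivAt.fun_pow 2
        simpa using this
      · exact (by fun_prop : Continuous fun y => 2 * f y * deriv f y).intervalIntegrable _ _
    have h2 : |∫ y in z..x, 2 * f y * deriv f y| ≤ A + W := by
      calc |∫ y in z..x, 2 * f y * deriv f y| ≤ |∫ y in z..x, (f y ^ 2 + deriv f y ^ 2)| := by
            have := intervalIntegral.norm_integral_le_abs_of_norm_le (μ := volume)
              (a := z) (b := x) (f := fun y => 2 * f y * deriv f y)
              (g := fun y => f y ^ 2 + deriv f y ^ 2)
              (Filter.Eventually.of_forall fun y => by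
                rw [Real.norm_eq_abs, abs_le]
                constructor <;> nlinarith [sq_nonneg (f y + deriv f y), sq_nonneg (f y - deriv f y)])
              ((by fun_prop : Continuous fun y => f y ^ 2 + deriv f y ^ 2).intervalIntegrable _ _)
            simpa using this
        _ ≤ |∫ y in (0:ℝ)..1, (f y ^ 2 + deriv f y ^ 2)| := by
            refine intervalIntegral.abs_integral_mono_interval ?_ ?_ ?_
            · rw [uIoc_of_le (zero_le_one' ℝ)]
              intro y hy
              rw [uIoc, mem_Ioc] at hy
              exact ⟨lt_of_le_of_lt (le_min hz.1 hx.1) hy.1, hy.2.trans (max_le hz.2 hx.2)⟩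
            · exact Filter.Eventually.of_forall fun y => by
                simp only [Pi.zero_apply]; positivity
            · exact hi1.add hi2
        _ = A + W := by
            rw [intervalIntegral.integral_add hi1 hi2, abs_of_nonneg (by positivity)]
    rw [h1] at h2
    linarith [(abs_le.1 h2).2]
  have := intervalIntegral.integral_mono_on (μ := volume) (zero_le_one' ℝ)
    (intervalIntegrable_const (c := f x ^ 2 - (A + W))) hi1 key
  simp at this
  linarith

theorem affc_hasDeriv (a b : ℝ) {g : ℝ → ℝ} {g' x : ℝ} (h : HasDerivAt g g' x) :
    HasDerivAt (fun y => affc a b (g y)) ((a - b) * g') x := by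
  unfold affc
  have := (h.mul_const a).fun_add ((h.const_sub 1).mul_const b)
  refine HasDerivAt.congr_deriv this ?_
  ring

theorem affc_contDiff (a b : ℝ) : ContDiff ℝ (⊤ : ℕ∞) (affc a b) := by
  unfold affc; fun_prop

theorem Smo.affc {f : ℝ → ℝ → ℝ} (h : Smo f) (a b : ℝ) : Smo (fun t x => affc a b (f t x)) :=
  (affc_contDiff a b).comp h

theorem Smo.mul {f g : ℝ → ℝ → ℝ} (hf : Smo f) (hg : Smo g) : Smo (fun t x => f t x * g t x) :=
  ContDiff.mul hf hg

theorem Smo.sub {f g : ℝ → ℝ → ℝ} (hf : Smo f) (hg : Smo g) : Smo (fun t x => f t x - g t x) :=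
  ContDiff.sub hf hg

theorem Smo.sigm {c ρ θ u : ℝ → ℝ → ℝ} (μp μm γp γm : ℝ) (hc : Smo c) (hρ : Smo ρ) (hθ : Smo θ)
    (hu : Smo u) : Smo (sigm μp μm γp γm c ρ θ u) := by
  have h1 : Smo (fun _ _ => (1:ℝ)) := contDiff_const
  exact ((hc.affc μp μm).mul hu.px).sub ((((hc.affc γp γm).sub h1).mul hρ).mul hθ)

theorem pdx_per {f : ℝ → ℝ → ℝ} (h : ∀ t x, f t (x + 1) = f t x) (t x : ℝ) :
    pdx f t (x + 1) = pdx f t x := by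
  unfold pdx
  rw [← deriv_comp_add_const]
  simp only [h]

theorem affc_pos {a b s : ℝ} (hs : s ∈ Icc (0:ℝ) 1) :
    min a b ≤ affc a b s := by
  unfold affc
  nlinarith [min_le_left a b, min_le_right a b, hs.1, hs.2]

theorem affc_le {a b s : ℝ} (hs : s ∈ Icc (0:ℝ) 1) : affc a b s ≤ max a b := by
  unfold affc
  nlinarith [le_max_left a b, le_max_right a b, hs.1, hs.2]

/-- Pointwise consequences of the equations at a fixed time. -/
theorem pde_point {μp μm γp γm kp km T : ℝ} {c ρ θ u : ℝ → ℝ → ℝ}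
    (hk : 0 < kp ∧ 0 < km)
    (hc : Smo c) (hρ : Smo ρ) (hθ : Smo θ) (hu : Smo u)
    (heq : MesoEqns μp μm γp γm kp km T c ρ θ u) {t : ℝ} (ht : t ∈ Icc (0:ℝ) T)
    (hc01 : ∀ x, c t x ∈ Icc (0:ℝ) 1) (hρ0 : ∀ x, 0 < ρ t x) (x : ℝ) :
    pdt c t x = - (u t x * pdx c t x) ∧
    pdt ρ t x = - (pdx ρ t x * u t x + ρ t x * pdx u t x) ∧
    pdt u t x = pdx (sigm μp μm γp γm c ρ θ u) t x / ρ t x - u t x * pdx u t x ∧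
    pdt (sigm μp μm γp γm c ρ θ u) t x =
      affc μp μm (c t x) * deriv (fun y => pdx (sigm μp μm γp γm c ρ θ u) t y / ρ t y) x
      - u t x * pdx (sigm μp μm γp γm c ρ θ u) t x
      - (1 + (affc γp γm (c t x) - 1) / affc kp km (c t x)) * pdx u t x
        * sigm μp μm γp γm c ρ θ u t x := by
  obtain ⟨-, -, -, -, e1, e2, e3, e4⟩ := heq
  have hσ := Smo.sigm μp μm γp γm hc hρ hθ hu
  set σ := sigm μp μm γp γm c ρ θ u with hσdef
  have a1 : ∀ x, pdt c t x = - (u t x * pdx c t x) := fun x => by linarith [e1 t ht x]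
  have a2 : ∀ x, pdt ρ t x = - (pdx ρ t x * u t x + ρ t x * pdx u t x) := fun x => by
    have h := e2 t ht x
    have h1 : pdx (fun s y => ρ s y * u s y) t x = pdx ρ t x * u t x + ρ t x * pdx u t x :=
      ((hρ.hx t x).fun_mul (hu.hx t x)).deriv
    linarith
  have a3 : ∀ x, ρ t x * (pdt u t x + u t x * pdx u t x) = pdx σ t x := fun x => by
    have h := e3 t ht x
    have h1 : pdt (fun s y => ρ s y * u s y) t x = pdt ρ t x * u t x + ρ t x * pdt u t x :=
      ((hρ.ht t x).fun_mul (hu.ht t x)).deriv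
    have h2 := ((hρ.hx t x).fun_mul ((hu.hx t x).fun_pow 2)).deriv
    have h3 : pdx (fun s y => ρ s y * u s y ^ 2) t x = _ := h2
    rw [h1, h3, a2] at h
    rw [← h]; push_cast; ring
  have a3' : ∀ x, pdt u t x = pdx σ t x / ρ t x - u t x * pdx u t x := fun x => by
    have := (hρ0 x).ne'
    rw [← a3 x]; field_simp; ring
  have a4 : ρ t x * (affc kp km (c t x) * (pdt θ t x + u t x * pdx θ t x))
      = σ t x * pdx u t x := by
    have h := e4 t ht x
    have hEt : HasDerivAt (fun s => Etot kp km c θ u s x) (u t x * pdt u t x +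
        ((kp - km) * pdt c t x * θ t x + affc kp km (c t x) * pdt θ t x)) t := by
      have := (((hu.ht t x).fun_pow 2).div_const 2).fun_add
        ((affc_hasDeriv kp km (hc.ht t x)).fun_mul (hθ.ht t x))
      refine HasDerivAt.congr_deriv this ?_
      push_cast; ring
    have hEx : HasDerivAt (fun y => Etot kp km c θ u t y) (u t x * pdx u t x +
        ((kp - km) * pdx c t x * θ t x + affc kp km (c t x) * pdx θ t x)) x := by
      have := (((hu.hx t x).fun_pow 2).div_const 2).fun_add
        ((affc_hasDeriv kp km (hc.hx t x)).fun_mul (hθ.hx t x))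
      refine HasDerivAt.congr_deriv this ?_
      push_cast; ring
    have h1 : pdt (fun s y => ρ s y * Etot kp km c θ u s y) t x = _ :=
      ((hρ.ht t x).fun_mul hEt).deriv
    have h2 : pdx (fun s y => ρ s y * Etot kp km c θ u s y * u s y) t x = _ :=
      (((hρ.hx t x).fun_mul hEx).fun_mul (hu.hx t x)).deriv
    have h3 : pdx (fun s y => σ s y * u s y) t x = _ :=
      ((hσ.hx t x).fun_mul (hu.hx t x)).deriv
    rw [h1, h2, h3, a2, a1, ← a3 x] at h
    linear_combination h
  have hG : DifferentiableAt ℝ (fun y => pdx σ t y / ρ t y) x :=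
    ((hσ.px.hx t x).div (hρ.hx t x) (hρ0 x).ne').differentiableAt
  have a5 : pdt (pdx u) t x = deriv (fun y => pdx σ t y / ρ t y) x
      - (pdx u t x * pdx u t x + u t x * pdx (pdx u) t x) := by
    rw [hu.swap]
    have : (fun y => pdt u t y) = fun y => pdx σ t y / ρ t y - u t y * pdx u t y := funext a3'
    unfold pdx at *
    rw [this]
    exact (hG.hasDerivAt.fun_sub ((hu.hx t x).fun_mul (hu.px.hx t x))).deriv
  refine ⟨a1 x, a2 x, a3' x, ?_⟩
  have st : pdt σ t x = _ := (((affc_hasDeriv μp μm (hc.ht t x)).fun_mul (hu.px.ht t x)).fun_sub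
    ((((affc_hasDeriv γp γm (hc.ht t x)).sub_const 1).fun_mul (hρ.ht t x)).fun_mul (hθ.ht t x))).deriv
  have sx : pdx σ t x = _ := (((affc_hasDeriv μp μm (hc.hx t x)).fun_mul (hu.px.hx t x)).fun_sub
    ((((affc_hasDeriv γp γm (hc.hx t x)).sub_const 1).fun_mul (hρ.hx t x)).fun_mul (hθ.hx t x))).deriv
  have hkpos : 0 < affc kp km (c t x) :=
    lt_of_lt_of_le (lt_min hk.1 hk.2) (affc_pos (hc01 x))
  have a4' : ρ t x * (pdt θ t x + u t x * pdx θ t x)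
      = σ t x * pdx u t x / affc kp km (c t x) := by
    rw [← a4]; field_simp
  rw [st]
  generalize deriv (fun y => pdx σ t y / ρ t y) x = Gx at *
  rw [sx, a5, a1, a2]
  have hs : σ t x = affc μp μm (c t x) * pdx u t x - (affc γp γm (c t x) - 1) * ρ t x * θ t x := rfl
  have e : (1 + (affc γp γm (c t x) - 1) / affc kp km (c t x)) * pdx u t x * σ t x
    = pdx u t x * σ t x
      + (affc γp γm (c t x) - 1) * (σ t x * pdx u t x / affc kp km (c t x)) := by
    field_simp
  rw [e, ← a4', hs]
  ring

/-- Kinetic energy. -/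
noncomputable def Kin (ρ u : ℝ → ℝ → ℝ) (t : ℝ) : ℝ :=
  ∫ x in (0:ℝ)..1, ρ t x * u t x ^ 2 / 2

/-- Weighted `L²` norm of the stress. -/
noncomputable def Yen (μp μm : ℝ) (c σ : ℝ → ℝ → ℝ) (t : ℝ) : ℝ :=
  ∫ x in (0:ℝ)..1, σ t x ^ 2 / (2 * affc μp μm (c t x))

theorem int_exact {f H R : ℝ → ℝ} (hH : ContDiff ℝ 1 H) (hp : H 1 = H 0) (hR : Continuous R)
    (h : ∀ x, f x = deriv H x + R x) : ∫ x in (0:ℝ)..1, f x = ∫ x in (0:ℝ)..1, R x := by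
  have : f = fun x => deriv H x + R x := funext h
  rw [this, intervalIntegral.integral_add
    ((hH.continuous_deriv (by norm_num)).intervalIntegrable _ _) (hR.intervalIntegrable _ _),
    int_per hH hp, zero_add]

theorem kin_deriv {μp μm γp γm kp km T : ℝ} {c ρ θ u : ℝ → ℝ → ℝ}
    (hk : 0 < kp ∧ 0 < km)
    (hc : Smo c) (hρ : Smo ρ) (hθ : Smo θ) (hu : Smo u)
    (heq : MesoEqns μp μm γp γm kp km T c ρ θ u) {t : ℝ} (ht : t ∈ Icc (0:ℝ) T)
    (hc01 : ∀ x, c t x ∈ Icc (0:ℝ) 1) (hρ0 : ∀ x, 0 < ρ t x) :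
    HasDerivAt (Kin ρ u)
      (∫ x in (0:ℝ)..1, - (sigm μp μm γp γm c ρ θ u t x * pdx u t x)) t := by
  have hσ := Smo.sigm μp μm γp γm hc hρ hθ hu
  have pp := pde_point hk hc hρ hθ hu heq ht hc01 hρ0
  obtain ⟨p1, p2, p3, p4, -⟩ := heq
  set σ := sigm μp μm γp γm c ρ θ u with hσdef
  have hσp : ∀ x, σ t (x + 1) = σ t x := fun x => by
    simp only [hσdef, sigm, p1, p2, p3, pdx_per p4]
  have h1 : HasDerivAt (Kin ρ u) (∫ x in (0:ℝ)..1, pdt (fun t x => ρ t x * u t x ^ 2 / 2) t x) t := by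
    refine param_deriv (F := fun t x => ρ t x * u t x ^ 2 / 2) ?_
    intro x _
    have : ContDiff ℝ 1 (fun p : ℝ × ℝ => uncurry ρ p * uncurry u p ^ 2 / 2) :=
      (hρ.c1.mul (hu.c1.pow 2)).div_const 2
    exact this.contDiffAt
  refine h1.congr_deriv ?_
  have sρ := hρ.slice t
  have su := hu.slice t
  have sσ := hσ.slice t
  refine int_exact (H := fun x => σ t x * u t x - ρ t x * u t x ^ 3 / 2) ?_ ?_ ?_ ?_
  · have : ContDiff ℝ (⊤ : ℕ∞) (fun x => σ t x * u t x - ρ t x * u t x ^ 3 / 2) := by fun_prop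
    exact this.of_le (by exact_mod_cast le_top)
  · have e1 := hσp 0; have e2 := p2 t 0; have e4 := p4 t 0
    simp only [zero_add] at e1 e2 e4
    simp only [e1, e2, e4]
  · have := hσ.cx t; have := hu.px.cx t
    fun_prop
  · intro x
    obtain ⟨-, q2, q3, -⟩ := pp x
    have d1 : pdt (fun t x => ρ t x * u t x ^ 2 / 2) t x = _ :=
      (((hρ.ht t x).fun_mul ((hu.ht t x).fun_pow 2)).div_const 2).deriv
    have d2 := (((hσ.hx t x).fun_mul (hu.hx t x)).fun_sub
      (((hρ.hx t x).fun_mul ((hu.hx t x).fun_pow 3)).div_const 2)).deriv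
    rw [d1, d2, q2, q3]
    have := (hρ0 x).ne'
    push_cast
    field_simp
    ring

theorem yen_deriv {μp μm γp γm kp km T : ℝ} {c ρ θ u : ℝ → ℝ → ℝ}
    (hμ : 0 < μp ∧ 0 < μm) (hk : 0 < kp ∧ 0 < km)
    (hc : Smo c) (hρ : Smo ρ) (hθ : Smo θ) (hu : Smo u)
    (heq : MesoEqns μp μm γp γm kp km T c ρ θ u) {t : ℝ} (ht : t ∈ Icc (0:ℝ) T)
    (hc01 : ∀ x, c t x ∈ Icc (0:ℝ) 1) (hρ0 : ∀ x, 0 < ρ t x) :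
    HasDerivAt (Yen μp μm c (sigm μp μm γp γm c ρ θ u))
      (∫ x in (0:ℝ)..1, (- (pdx (sigm μp μm γp γm c ρ θ u) t x ^ 2 / ρ t x)
        - (1 / 2 + (affc γp γm (c t x) - 1) / affc kp km (c t x)) * pdx u t x *
          sigm μp μm γp γm c ρ θ u t x ^ 2 / affc μp μm (c t x))) t := by
  have hσ := Smo.sigm μp μm γp γm hc hρ hθ hu
  have pp := pde_point hk hc hρ hθ hu heq ht hc01 hρ0
  obtain ⟨p1, p2, p3, p4, -⟩ := heq
  set σ := sigm μp μm γp γm c ρ θ u with hσdef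
  have hkpos : ∀ x, 0 < affc kp km (c t x) := fun x =>
    lt_of_lt_of_le (lt_min hk.1 hk.2) (affc_pos (hc01 x))
  have hμpos : ∀ x, 0 < affc μp μm (c t x) := fun x =>
    lt_of_lt_of_le (lt_min hμ.1 hμ.2) (affc_pos (hc01 x))
  have hσp' : ∀ x, σ t (x + 1) = σ t x := fun x => by
    simp only [hσdef, sigm, p1, p2, p3, pdx_per p4]
  have hσp : ∀ t x, σ t (x + 1) = σ t x := fun t x => by
    simp only [hσdef, sigm, p1, p2, p3, pdx_per p4]
  have h1 : HasDerivAt (Yen μp μm c σ)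
      (∫ x in (0:ℝ)..1, pdt (fun t x => σ t x ^ 2 / (2 * affc μp μm (c t x))) t x) t := by
    refine param_deriv (F := fun t x => σ t x ^ 2 / (2 * affc μp μm (c t x))) ?_
    intro x _
    have hm := (hc.affc μp μm).c1
    have : ContDiffAt ℝ 1 (fun p : ℝ × ℝ => uncurry σ p ^ 2 /
        (2 * uncurry (fun t x => affc μp μm (c t x)) p)) (t, x) :=
      (hσ.c1.pow 2).contDiffAt.div (contDiff_const.mul hm).contDiffAt
        (by have := hμpos x; simp only [uncurry_apply_pair]; positivity)
    exact this
  refine h1.congr_deriv ?_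
  have sρ := hρ.slice t
  have su := hu.slice t
  have sσ := hσ.slice t
  have sσx := hσ.px.slice t
  have sm := (hc.affc μp μm).slice t
  have sk := (hc.affc kp km).slice t
  have sg := (hc.affc γp γm).slice t
  have sv := hu.px.slice t
  have nμ : ∀ x, affc μp μm (c t x) ≠ 0 := fun x => (hμpos x).ne'
  have nμ2 : ∀ x, 2 * affc μp μm (c t x) ≠ 0 := fun x => by have := hμpos x; positivity
  have nk : ∀ x, affc kp km (c t x) ≠ 0 := fun x => (hkpos x).ne'
  have nρ : ∀ x, ρ t x ≠ 0 := fun x => (hρ0 x).ne'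
  refine int_exact (H := fun x => σ t x * (pdx σ t x / ρ t x)
    - u t x * (σ t x ^ 2 / (2 * affc μp μm (c t x)))) ?_ ?_ ?_ ?_
  · have : ContDiff ℝ (⊤ : ℕ∞) (fun x => σ t x * (pdx σ t x / ρ t x)
      - u t x * (σ t x ^ 2 / (2 * affc μp μm (c t x)))) :=
      (sσ.mul (sσx.div sρ nρ)).sub (su.mul ((sσ.pow 2).div (contDiff_const.mul sm) nμ2))
    exact this.of_le (by exact_mod_cast le_top)
  · have e1 := hσp' 0; have e2 := p2 t 0; have e4 := p4 t 0
    have e5 := p1 t 0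
    have e6 := pdx_per hσp t 0
    simp only [zero_add] at e1 e2 e4 e5 e6
    simp only [e1, e2, e4, e5, e6]
  · exact ((sσx.continuous.pow 2).div sρ.continuous nρ).neg.sub
      ((((continuous_const.add ((sg.continuous.sub continuous_const).div sk.continuous nk)).mul
        sv.continuous).mul (sσ.continuous.pow 2)).div sm.continuous nμ)
  · intro x
    obtain ⟨q1, -, -, q4⟩ := pp x
    have hG : DifferentiableAt ℝ (fun y => pdx σ t y / ρ t y) x :=
      ((hσ.px.hx t x).div (hρ.hx t x) (hρ0 x).ne').differentiableAt
    have d1 : pdt (fun t x => σ t x ^ 2 / (2 * affc μp μm (c t x))) t x = _ :=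
      (((hσ.ht t x).fun_pow 2).fun_div ((affc_hasDeriv μp μm (hc.ht t x)).const_mul 2) (nμ2 x)).deriv
    have d2 := (((hσ.hx t x).fun_mul hG.hasDerivAt).fun_sub
      ((hu.hx t x).fun_mul (((hσ.hx t x).fun_pow 2).fun_div
        ((affc_hasDeriv μp μm (hc.hx t x)).const_mul 2) (nμ2 x)))).deriv
    rw [d1, d2, q1, q4]
    generalize deriv (fun y => pdx σ t y / ρ t y) x = Gx
    have h1 := nμ x
    have h2 := nk x
    have h3 := nρ x
    push_cast
    field_simp
    ring

theorem slice_est {σ σx v μ q ρ : ℝ → ℝ} {m M P R κ : ℝ}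
    (hσ : ContDiff ℝ 1 σ) (hσx : deriv σ = σx) (hv : Continuous v) (hμ : Continuous μ)
    (hq : Continuous q) (hρ : Continuous ρ)
    (hm : 0 < m) (hμm : ∀ x, m ≤ μ x) (hμM : ∀ x, μ x ≤ M) (hR : 0 < R)
    (hρ0 : ∀ x, 0 < ρ x) (hρR : ∀ x, ρ x ≤ R) (hq0 : ∀ x, 0 ≤ q x) (hqκ : ∀ x, q x ≤ κ)
    (hp0 : ∀ x, 0 ≤ μ x * v x - σ x) (hpP : ∀ x, μ x * v x - σ x ≤ P) :
    0 ≤ (∫ x in (0:ℝ)..1, σ x ^ 2 / (2 * μ x)) ∧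
    (∫ x in (0:ℝ)..1, - (σ x * v x)) ≤
      - (∫ x in (0:ℝ)..1, σ x ^ 2 / (2 * μ x)) + P ^ 2 / (2 * m) ∧
    (∫ x in (0:ℝ)..1, (- (σx x ^ 2 / ρ x) - q x * v x * σ x ^ 2 / μ x)) ≤
      - (∫ x in (0:ℝ)..1, σx x ^ 2) / (2 * R) + (M / R + (2 * κ / m) ^ 2 * R) *
        (1 + ∫ x in (0:ℝ)..1, σ x ^ 2 / (2 * μ x)) * (∫ x in (0:ℝ)..1, σ x ^ 2 / (2 * μ x)) ∧
    (∫ x in (0:ℝ)..1, v x ^ 2) ≤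
      4 * (∫ x in (0:ℝ)..1, σ x ^ 2 / (2 * μ x)) / m + 2 * P ^ 2 / m ^ 2 ∧
    (⨆ x : Icc (0:ℝ) 1, |v x.1|) ^ 2 ≤ (8 * M * (∫ x in (0:ℝ)..1, σ x ^ 2 / (2 * μ x))
      + 4 * (∫ x in (0:ℝ)..1, σx x ^ 2) + 2 * P ^ 2) / m ^ 2 ∧
    (∫ x in (0:ℝ)..1, σ x ^ 2 / (2 * μ x)) ≤ (∫ x in (0:ℝ)..1, σ x ^ 2) / (2 * m) := by
  have hσc : Continuous σ := hσ.continuous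
  have hσxc : Continuous σx := hσx ▸ hσ.continuous_deriv (by norm_num)
  have μ0 : ∀ x, 0 < μ x := fun x => hm.trans_le (hμm x)
  have nμ : ∀ x, μ x ≠ 0 := fun x => (μ0 x).ne'
  have nμ2 : ∀ x, 2 * μ x ≠ 0 := fun x => by have := μ0 x; positivity
  have nρ : ∀ x, ρ x ≠ 0 := fun x => (hρ0 x).ne'
  have hM : 0 < M := (μ0 0).trans_le (hμM 0)
  have hP : 0 ≤ P := (hp0 0).trans (hpP 0)
  have hκ : 0 ≤ κ := (hq0 0).trans (hqκ 0)
  have cY : Continuous fun x => σ x ^ 2 / (2 * μ x) :=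
    (hσc.pow 2).div (continuous_const.mul hμ) nμ2
  have iY : IntervalIntegrable (fun x => σ x ^ 2 / (2 * μ x)) volume 0 1 :=
    cY.intervalIntegrable _ _
  have iW : IntervalIntegrable (fun x => σx x ^ 2) volume 0 1 :=
    (hσxc.pow 2).intervalIntegrable _ _
  have iS : IntervalIntegrable (fun x => σ x ^ 2) volume 0 1 :=
    (hσc.pow 2).intervalIntegrable _ _
  have iV : IntervalIntegrable (fun x => v x ^ 2) volume 0 1 :=
    (hv.pow 2).intervalIntegrable _ _
  have iSV : IntervalIntegrable (fun x => - (σ x * v x)) volume 0 1 :=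
    (hσc.mul hv).neg.intervalIntegrable _ _
  have iD : IntervalIntegrable (fun x => - (σx x ^ 2 / ρ x) - q x * v x * σ x ^ 2 / μ x)
      volume 0 1 :=
    (((hσxc.pow 2).div hρ nρ).neg.sub
      (((hq.mul hv).mul (hσc.pow 2)).div hμ nμ)).intervalIntegrable _ _
  have iYn : IntervalIntegrable (fun x => - (σ x ^ 2 / (2 * μ x))) volume 0 1 := iY.neg
  have iWn : IntervalIntegrable (fun x => - (σx x ^ 2 / R)) volume 0 1 := (iW.div_const R).neg
  have ic : ∀ a : ℝ, IntervalIntegrable (fun _ => a) volume 0 1 :=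
    fun a => intervalIntegrable_const
  have hS : (∫ x in (0:ℝ)..1, σ x ^ 2) ≤ 2 * M * ∫ x in (0:ℝ)..1, σ x ^ 2 / (2 * μ x) := by
    rw [← intervalIntegral.integral_const_mul]
    refine intervalIntegral.integral_mono_on zero_le_one iS (iY.const_mul _) fun x _ => ?_
    have := μ0 x
    rw [← mul_div_assoc, le_div_iff₀ (by positivity)]
    nlinarith [hμM x, sq_nonneg (σ x)]
  have hS2 : (∫ x in (0:ℝ)..1, σ x ^ 2 / (2 * μ x)) ≤ (∫ x in (0:ℝ)..1, σ x ^ 2) / (2 * m) := by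
    rw [← intervalIntegral.integral_div]
    refine intervalIntegral.integral_mono_on zero_le_one iY (iS.div_const _) fun x _ => ?_
    have := hμm x
    gcongr
  have hsob : ∀ x ∈ Icc (0:ℝ) 1, σ x ^ 2 ≤ 2 * (∫ y in (0:ℝ)..1, σ y ^ 2)
      + 2 * (∫ y in (0:ℝ)..1, σx y ^ 2) := by
    intro x hx
    rw [← hσx]; exact sobo hσ hx
  have hA : (∫ x in (0:ℝ)..1, - (σ x * v x)) ≤
      - (∫ x in (0:ℝ)..1, σ x ^ 2 / (2 * μ x)) + P ^ 2 / (2 * m) := by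
    have : - (∫ x in (0:ℝ)..1, σ x ^ 2 / (2 * μ x)) + P ^ 2 / (2 * m)
        = ∫ x in (0:ℝ)..1, (- (σ x ^ 2 / (2 * μ x)) + P ^ 2 / (2 * m)) := by
      rw [intervalIntegral.integral_add iYn (ic _), intervalIntegral.integral_neg]; simp
    rw [this]
    refine intervalIntegral.integral_mono_on zero_le_one iSV (iY.neg.add (ic _)) fun x _ => ?_
    have h0 := μ0 x
    have h1 : P ^ 2 / (2 * μ x) ≤ P ^ 2 / (2 * m) := by have := hμm x; gcongr
    have h2 : - (σ x * v x) ≤ - (σ x ^ 2 / (2 * μ x)) + P ^ 2 / (2 * μ x) := by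
      have e : - (σ x ^ 2 / (2 * μ x)) + P ^ 2 / (2 * μ x)
          = (P ^ 2 - σ x ^ 2) / (2 * μ x) := by ring
      rw [e, le_div_iff₀ (by positivity)]
      nlinarith [hp0 x, hpP x, sq_nonneg (σ x + (μ x * v x - σ x))]
    linarith
  have hVp : ∀ x, v x ^ 2 ≤ 2 * σ x ^ 2 / μ x ^ 2 + 2 * P ^ 2 / μ x ^ 2 := by
    intro x
    have h0 := μ0 x
    rw [← add_div, le_div_iff₀ (by positivity)]
    have h1 : (μ x * v x - σ x) ^ 2 ≤ P ^ 2 := pow_le_pow_left₀ (hp0 x) (hpP x) 2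
    nlinarith [sq_nonneg (σ x - (μ x * v x - σ x))]
  have hPm : ∀ x, 2 * P ^ 2 / μ x ^ 2 ≤ 2 * P ^ 2 / m ^ 2 := fun x => by
    have := hμm x; gcongr
  have hC : (∫ x in (0:ℝ)..1, v x ^ 2) ≤
      4 * (∫ x in (0:ℝ)..1, σ x ^ 2 / (2 * μ x)) / m + 2 * P ^ 2 / m ^ 2 := by
    have : 4 * (∫ x in (0:ℝ)..1, σ x ^ 2 / (2 * μ x)) / m + 2 * P ^ 2 / m ^ 2
        = ∫ x in (0:ℝ)..1, (4 / m * (σ x ^ 2 / (2 * μ x)) + 2 * P ^ 2 / m ^ 2) := by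
      rw [intervalIntegral.integral_add (iY.const_mul _) (ic _),
        intervalIntegral.integral_const_mul]
      simp; ring
    rw [this]
    refine intervalIntegral.integral_mono_on zero_le_one iV ((iY.const_mul _).add (ic _))
      fun x _ => ?_
    have h1 : 2 * σ x ^ 2 / μ x ^ 2 ≤ 4 / m * (σ x ^ 2 / (2 * μ x)) := by
      have h0 := μ0 x
      have e : 4 / m * (σ x ^ 2 / (2 * μ x)) = 2 * σ x ^ 2 / (m * μ x) := by
        field_simp; ring
      rw [e]
      have := hμm x
      gcongr
      nlinarith
    linarith [hVp x, hPm x]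
  set y := ∫ x in (0:ℝ)..1, σ x ^ 2 / (2 * μ x) with hy
  set w := ∫ x in (0:ℝ)..1, σx x ^ 2 with hw
  have y0 : 0 ≤ y := intervalIntegral.integral_nonneg zero_le_one fun x _ => by
    have := μ0 x; positivity
  have w0 : 0 ≤ w := intervalIntegral.integral_nonneg zero_le_one fun x _ => sq_nonneg _
  have hsob' : ∀ x ∈ Icc (0:ℝ) 1, σ x ^ 2 ≤ 4 * M * y + 2 * w := fun x hx => by
    linarith [hsob x hx]
  refine ⟨y0, hA, ?_, hC, ?_, hS2⟩
  · set s := Real.sqrt (4 * M * y + 2 * w) with hs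
    have s0 : 0 ≤ s := Real.sqrt_nonneg _
    have s2 : s ^ 2 = 4 * M * y + 2 * w := Real.sq_sqrt (by positivity)
    have hσs : ∀ x ∈ Icc (0:ℝ) 1, |σ x| ≤ s := fun x hx => Real.abs_le_sqrt (hsob' x hx)
    have h1 : (∫ x in (0:ℝ)..1, (- (σx x ^ 2 / ρ x) - q x * v x * σ x ^ 2 / μ x)) ≤
        - (w / R) + (2 * κ / m) * s * y := by
      have : - (w / R) + (2 * κ / m) * s * y = ∫ x in (0:ℝ)..1,
          (- (σx x ^ 2 / R) + (2 * κ / m) * s * (σ x ^ 2 / (2 * μ x))) := by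
        rw [intervalIntegral.integral_add iWn (iY.const_mul _),
          intervalIntegral.integral_const_mul, intervalIntegral.integral_neg,
          intervalIntegral.integral_div]
      rw [this]
      refine intervalIntegral.integral_mono_on zero_le_one iD
        ((iW.div_const _).neg.add (iY.const_mul _)) fun x hx => ?_
      have h0 := μ0 x
      have a1 : σx x ^ 2 / R ≤ σx x ^ 2 / ρ x := by
        have := hρR x; have := hρ0 x; gcongr
      have a2 : - (q x * v x * σ x ^ 2 / μ x) ≤ (2 * κ / m) * s * (σ x ^ 2 / (2 * μ x)) := by
        have b1 : - (v x) ≤ s / m := by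
          rw [le_div_iff₀ hm]
          have c1 : - (μ x * v x) ≤ s := by
            linarith [hp0 x, neg_abs_le (σ x), hσs x hx]
          by_cases hvx : 0 ≤ v x
          · nlinarith
          · push Not at hvx
            nlinarith [hμm x]
        have b2 : - (q x * v x) ≤ κ * (s / m) := by
          have : 0 ≤ s / m := by positivity
          nlinarith [hq0 x, hqκ x]
        have e1 : - (q x * v x * σ x ^ 2 / μ x) = - (q x * v x) * (σ x ^ 2 / μ x) := by ring
        have e2 : (2 * κ / m) * s * (σ x ^ 2 / (2 * μ x)) = κ * (s / m) * (σ x ^ 2 / μ x) := by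
          field_simp
        rw [e1, e2]
        exact mul_le_mul_of_nonneg_right b2 (by positivity)
      linarith
    have h2 : (2 * κ / m) * s * y ≤ s ^ 2 / (4 * R) + (2 * κ / m) ^ 2 * R * y ^ 2 := by
      generalize 2 * κ / m = B
      have : s ^ 2 / (4 * R) + B ^ 2 * R * y ^ 2 - B * s * y
        = (s - 2 * R * B * y) ^ 2 / (4 * R) := by field_simp; ring
      have h3 : 0 ≤ (s - 2 * R * B * y) ^ 2 / (4 * R) := by positivity
      linarith
    have h3 : s ^ 2 / (4 * R) = M / R * y + w / (2 * R) := by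
      rw [s2]; field_simp; ring
    have h4 : -w / (2 * R) = - (w / R) + w / (2 * R) := by field_simp; ring
    have h5 : 0 ≤ M / R * y ^ 2 := by positivity
    have h6 : 0 ≤ (2 * κ / m) ^ 2 * R * y := by positivity
    rw [h4]
    nlinarith
  · have hb : ∀ x : Icc (0:ℝ) 1, |v x.1| ≤ Real.sqrt ((8 * M * y + 4 * w + 2 * P ^ 2) / m ^ 2) := by
      intro x
      refine Real.abs_le_sqrt ?_
      have h1 : 2 * σ x.1 ^ 2 / μ x.1 ^ 2 ≤ 2 * (4 * M * y + 2 * w) / m ^ 2 := by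
        have := hμm x.1; have := hsob' x.1 x.2
        gcongr
      have h2 : (8 * M * y + 4 * w + 2 * P ^ 2) / m ^ 2
        = 2 * (4 * M * y + 2 * w) / m ^ 2 + 2 * P ^ 2 / m ^ 2 := by ring
      linarith [hVp x.1, hPm x.1]
    have : Nonempty (Icc (0:ℝ) 1) := ⟨⟨0, by simp⟩⟩
    have h1 := ciSup_le hb
    have h0 : 0 ≤ ⨆ x : Icc (0:ℝ) 1, |v x.1| := Real.iSup_nonneg fun x => abs_nonneg _
    calc _ ≤ Real.sqrt ((8 * M * y + 4 * w + 2 * P ^ 2) / m ^ 2) ^ 2 :=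
          pow_le_pow_left₀ h0 h1 2
      _ = _ := Real.sq_sqrt (by positivity)

theorem ode_est {y K w y' K' g : ℝ → ℝ} {T A b r D e Y0 E0 : ℝ} (hT : 0 < T) (hA : 0 ≤ A)
    (hb : 0 ≤ b) (hr : 0 < r) (hD : 0 ≤ D) (he : 0 ≤ e)
    (hy : ∀ t ∈ Icc (0:ℝ) T, HasDerivAt y (y' t) t)
    (hK : ∀ t ∈ Icc (0:ℝ) T, HasDerivAt K (K' t) t)
    (y0 : ∀ t ∈ Icc (0:ℝ) T, 0 ≤ y t) (K0 : ∀ t ∈ Icc (0:ℝ) T, 0 ≤ K t)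
    (w0 : ∀ t ∈ Icc (0:ℝ) T, 0 ≤ w t)
    (h1 : ∀ t ∈ Icc (0:ℝ) T, K' t ≤ - y t + b)
    (h2 : ∀ t ∈ Icc (0:ℝ) T, y' t ≤ - w t / r + A * (1 + y t) * y t)
    (hg : ∀ t ∈ Icc (0:ℝ) T, g t ≤ D * y t + e * w t + b)
    (hy0 : y 0 ≤ Y0) (hK0 : K 0 ≤ E0) :
    (∀ t ∈ Icc (0:ℝ) T, y t ≤ (1 + Y0) * Real.exp (A * (E0 + b * T))) ∧
    (∫ t in (0:ℝ)..T, g t) ≤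
      (D * ((1 + Y0) * Real.exp (A * (E0 + b * T))) + e * r * (A *
        (1 + (1 + Y0) * Real.exp (A * (E0 + b * T))) * ((1 + Y0) * Real.exp (A * (E0 + b * T))))
        + b) * T + e * r * ((1 + Y0) * Real.exp (A * (E0 + b * T))) := by
  have z0 : (0:ℝ) ∈ Icc (0:ℝ) T := ⟨le_rfl, hT.le⟩
  have zT : T ∈ Icc (0:ℝ) T := ⟨hT.le, le_rfl⟩
  set Y := (1 + Y0) * Real.exp (A * (E0 + b * T)) with hY
  have hL : ∀ t ∈ Icc (0:ℝ) T, HasDerivAt (fun t => (1 + y t) * Real.exp (A * (K t - b * t)))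
      (y' t * Real.exp (A * (K t - b * t)) +
        (1 + y t) * (Real.exp (A * (K t - b * t)) * (A * (K' t - b * 1)))) t := fun t ht =>
    ((hy t ht).const_add 1).fun_mul
      ((((hK t ht).fun_sub ((hasDerivAt_id t).const_mul b)).const_mul A).exp)
  have hanti : AntitoneOn (fun t => (1 + y t) * Real.exp (A * (K t - b * t))) (Icc 0 T) := by
    refine antitoneOn_of_deriv_nonpos (convex_Icc 0 T)
      (fun t ht => (hL t ht).continuousAt.continuousWithinAt)
      (fun t ht => (hL t (interior_subset ht)).differentiableAt.differentiableWithinAt) ?_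
    intro t ht
    have ht' := interior_subset ht
    rw [(hL t ht').deriv]
    have e : y' t * Real.exp (A * (K t - b * t)) +
        (1 + y t) * (Real.exp (A * (K t - b * t)) * (A * (K' t - b * 1)))
        = Real.exp (A * (K t - b * t)) * (y' t + A * (1 + y t) * (K' t - b)) := by ring
    rw [e]
    refine mul_nonpos_of_nonneg_of_nonpos (Real.exp_pos _).le ?_
    have a1 := h2 t ht'
    have a2 : A * (1 + y t) * (K' t - b) ≤ A * (1 + y t) * (- y t) :=
      mul_le_mul_of_nonneg_left (by linarith [h1 t ht'])
        (mul_nonneg hA (by linarith [y0 t ht']))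
    have a3 : - w t / r ≤ 0 := div_nonpos_of_nonpos_of_nonneg (by linarith [w0 t ht']) hr.le
    linarith
  have hYb : ∀ t ∈ Icc (0:ℝ) T, y t ≤ Y := by
    intro t ht
    have h := hanti z0 ht ht.1
    simp only [mul_zero, sub_zero] at h
    have b1 : Real.exp (A * (K 0)) ≤ Real.exp (A * E0) := by gcongr
    have b2 : Real.exp (A * (-(b * T))) ≤ Real.exp (A * (K t - b * t)) := by
      have : b * t ≤ b * T := mul_le_mul_of_nonneg_left ht.2 hb
      have := K0 t ht
      gcongr
      linarith
    have b3 : (1 + y t) * Real.exp (A * (-(b * T))) ≤ (1 + Y0) * Real.exp (A * E0) := by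
      have := y0 t ht
      have := y0 0 z0
      calc _ ≤ (1 + y t) * Real.exp (A * (K t - b * t)) := by gcongr
        _ ≤ (1 + y 0) * Real.exp (A * K 0) := h
        _ ≤ _ := by gcongr <;> linarith
    have b4 : Real.exp (A * (-(b * T))) * Real.exp (A * (b * T)) = 1 := by
      rw [← Real.exp_add]; simp
    have b5 : Real.exp (A * (E0 + b * T)) = Real.exp (A * E0) * Real.exp (A * (b * T)) := by
      rw [← Real.exp_add]; congr 1; ring
    have b6 := mul_le_mul_of_nonneg_right b3 (Real.exp_pos (A * (b * T))).le
    rw [mul_assoc, b4, mul_one, mul_assoc, ← b5] at b6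
    linarith
  refine ⟨hYb, ?_⟩
  have Ynn : 0 ≤ Y := (y0 0 z0).trans (hYb 0 z0)
  by_cases hi : IntervalIntegrable g volume 0 T
  · set Q := D * Y + e * r * (A * (1 + Y) * Y) + b with hQ
    have hd : ∀ t ∈ Icc (0:ℝ) T, HasDerivAt (fun t => Q * t - e * r * y t)
        (Q * 1 - e * r * y' t) t := fun t ht =>
      ((hasDerivAt_id t).const_mul Q).fun_sub ((hy t ht).const_mul (e * r))
    have := integral_le_sub_of_hasDeriv_right_of_le (φ := g) hT.le
      (fun t ht => (hd t ht).continuousAt.continuousWithinAt)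
      (fun t ht => (hd t (Ioo_subset_Icc_self ht)).hasDerivWithinAt)
      (by rwa [intervalIntegrable_iff_integrableOn_Icc_of_le hT.le] at hi) (by
        intro t ht
        have ht' := Ioo_subset_Icc_self ht
        have a0 := y0 t ht'
        have a1 := hYb t ht'
        have a2 := hg t ht'
        have a3 := h2 t ht'
        have a4 : A * (1 + y t) * y t ≤ A * (1 + Y) * Y := by gcongr
        have a5 : w t ≤ r * (A * (1 + Y) * Y - y' t) := by
          have : w t / r ≤ A * (1 + Y) * Y - y' t := by
            have : - w t / r = - (w t / r) := by ring
            linarith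
          rw [div_le_iff₀ hr] at this
          linarith
        have a6 : e * w t ≤ e * (r * (A * (1 + Y) * Y - y' t)) :=
          mul_le_mul_of_nonneg_left a5 he
        have a7 : D * y t ≤ D * Y := mul_le_mul_of_nonneg_left a1 hD
        rw [hQ]
        linarith)
    have c1 : 0 ≤ e * r * y T := by have := y0 T zT; positivity
    have c2 : e * r * y 0 ≤ e * r * Y := by have := hYb 0 z0; gcongr
    simp only [mul_zero, zero_sub, sub_neg_eq_add] at this
    linarith
  · rw [intervalIntegral.integral_undef hi]
    positivity

/-- A priori estimate for the velocity gradient: there are constants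
`C₈, C₉ > 0` depending only on the physical constants, `ρ̲, ρ̄, θ̄`, `T`, the initial
total mass and energy, and `∫₀¹σ(0)²`, such that every smooth 1-periodic solution
with `0 ≤ c ≤ 1`, `ρ̲ ≤ ρ ≤ ρ̄`, `0 < θ̲ ≤ θ ≤ θ̄`, satisfies
`∫₀¹(∂ₓu(t))² ≤ C₈` for all `t ∈ [0,T]` and `∫₀ᵀ‖∂ₓu(t)‖_{L^∞(0,1)}² ≤ C₉`. -/
theorem stmt11 (μp μm γp γm kp km T ρlo ρbar θbar M0 E0 S0 : ℝ)
    (hconst : GoodConsts μp μm γp γm kp km) (hT : 0 < T)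
    (hρlo : 0 < ρlo) (hρ : ρlo ≤ ρbar) (hθbar : 0 < θbar) :
    ∃ C8 > (0:ℝ), ∃ C9 > (0:ℝ), ∀ c ρ θ u : ℝ → ℝ → ℝ,
      ContDiff ℝ (⊤ : ℕ∞) (uncurry c) → ContDiff ℝ (⊤ : ℕ∞) (uncurry ρ) →
      ContDiff ℝ (⊤ : ℕ∞) (uncurry θ) → ContDiff ℝ (⊤ : ℕ∞) (uncurry u) →
      (∀ t ∈ Icc (0:ℝ) T, ∀ x : ℝ,
        c t x ∈ Icc (0:ℝ) 1 ∧ ρlo ≤ ρ t x ∧ ρ t x ≤ ρbar ∧ θ t x ≤ θbar) →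
      (∃ θlo > (0:ℝ), ∀ t ∈ Icc (0:ℝ) T, ∀ x : ℝ, θlo ≤ θ t x) →
      MesoEqns μp μm γp γm kp km T c ρ θ u →
      (∫ x in (0:ℝ)..1, ρ 0 x) = M0 →
      (∫ x in (0:ℝ)..1, ρ 0 x * Etot kp km c θ u 0 x) = E0 →
      (∫ x in (0:ℝ)..1, (sigm μp μm γp γm c ρ θ u 0 x) ^ 2) = S0 →
      (∀ t ∈ Icc (0:ℝ) T, (∫ x in (0:ℝ)..1, (pdx u t x) ^ 2) ≤ C8)
      ∧ (∫ t in (0:ℝ)..T, (⨆ x : Icc (0:ℝ) 1, |pdx u t x.1|) ^ 2) ≤ C9 := by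
  obtain ⟨hμp, hμm, hγp, hγm, hkp, hkm⟩ := hconst
  have hm : 0 < min μp μm := lt_min hμp hμm
  have hkmin : 0 < min kp km := lt_min hkp hkm
  have hM : 0 < max μp μm := lt_max_of_lt_left hμp
  have hg : 0 < max γp γm - 1 := sub_pos.2 (lt_max_of_lt_left hγp)
  have hR : 0 < ρbar := hρlo.trans_le hρ
  set m := min μp μm with hmdef
  set kmin := min kp km with hkdef
  set M := max μp μm with hMdef
  set gm := max γp γm - 1 with hgdef
  obtain ⟨P, hPdef⟩ : ∃ P, P = gm * ρbar * θbar := ⟨_, rfl⟩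
  obtain ⟨κ, hκdef⟩ : ∃ κ, κ = 1 / 2 + gm / kmin := ⟨_, rfl⟩
  obtain ⟨A, hAdef⟩ : ∃ A, A = M / ρbar + (2 * κ / m) ^ 2 * ρbar := ⟨_, rfl⟩
  obtain ⟨b, hbdef⟩ : ∃ b, b = P ^ 2 / (2 * m) + 2 * P ^ 2 / m ^ 2 := ⟨_, rfl⟩
  obtain ⟨Y, hYdef⟩ : ∃ Y, Y = (1 + |S0| / (2 * m)) * Real.exp (A * (|E0| + b * T)) := ⟨_, rfl⟩
  have hP0 : 0 < P := by rw [hPdef]; positivity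
  have hA0 : 0 < A := by rw [hAdef]; positivity
  have hb0 : 0 < b := by rw [hbdef]; positivity
  have hY0 : 0 < Y := by rw [hYdef]; positivity
  refine ⟨4 * Y / m + 2 * P ^ 2 / m ^ 2, by positivity,
    (8 * M / m ^ 2 * Y + 4 / m ^ 2 * (2 * ρbar) * (A * (1 + Y) * Y) + b) * T
      + 4 / m ^ 2 * (2 * ρbar) * Y, by positivity, ?_⟩
  intro c ρ θ u hc hr hθ hu hbd hθlo heq _ hE hS
  obtain ⟨θlo, hθlo0, hθlo⟩ := hθlo
  replace hc : Smo c := hc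
  replace hr : Smo ρ := hr
  replace hθ : Smo θ := hθ
  replace hu : Smo u := hu
  have hσ : Smo (sigm μp μm γp γm c ρ θ u) := Smo.sigm μp μm γp γm hc hr hθ hu
  have hc01 : ∀ t ∈ Icc (0:ℝ) T, ∀ x, c t x ∈ Icc (0:ℝ) 1 := fun t ht x => (hbd t ht x).1
  have hρ0 : ∀ t ∈ Icc (0:ℝ) T, ∀ x, 0 < ρ t x := fun t ht x =>
    hρlo.trans_le (hbd t ht x).2.1
  have hθ0 : ∀ t ∈ Icc (0:ℝ) T, ∀ x, 0 < θ t x := fun t ht x => hθlo0.trans_le (hθlo t ht x)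
  have hkpos : ∀ t ∈ Icc (0:ℝ) T, ∀ x, kmin ≤ affc kp km (c t x) := fun t ht x =>
    affc_pos (hc01 t ht x)
  have hg0 : ∀ t ∈ Icc (0:ℝ) T, ∀ x, 0 ≤ affc γp γm (c t x) - 1 := fun t ht x => by
    have h1 := affc_pos (a := γp) (b := γm) (hc01 t ht x)
    have h2 : 1 < min γp γm := lt_min hγp hγm
    linarith
  have hg1 : ∀ t ∈ Icc (0:ℝ) T, ∀ x, affc γp γm (c t x) - 1 ≤ gm := fun t ht x => by
    have h1 := affc_le (a := γp) (b := γm) (hc01 t ht x)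
    linarith
  have est := fun t (ht : t ∈ Icc (0:ℝ) T) => slice_est
    (σ := fun x => sigm μp μm γp γm c ρ θ u t x)
    (σx := fun x => pdx (sigm μp μm γp γm c ρ θ u) t x) (v := fun x => pdx u t x)
    (μ := fun x => affc μp μm (c t x))
    (q := fun x => 1 / 2 + (affc γp γm (c t x) - 1) / affc kp km (c t x))
    (ρ := fun x => ρ t x) (m := m) (M := M) (P := P) (R := ρbar) (κ := κ)
    ((hσ.slice t).of_le (by exact_mod_cast le_top)) rfl (hu.px.cx t) ((hc.affc μp μm).cx t)
    (continuous_const.add ((((hc.affc γp γm).cx t).sub continuous_const).div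
      ((hc.affc kp km).cx t) fun x => (hkmin.trans_le (hkpos t ht x)).ne'))
    (hr.cx t) hm (fun x => affc_pos (hc01 t ht x)) (fun x => affc_le (hc01 t ht x)) hR
    (hρ0 t ht) (fun x => (hbd t ht x).2.2.1)
    (fun x => by
      have h1 := hg0 t ht x
      have h2 := hkmin.trans_le (hkpos t ht x)
      positivity)
    (fun x => by
      have h1 := hg1 t ht x
      have h2 := hkpos t ht x
      rw [hκdef]
      gcongr)
    (fun x => by
      have h1 := hg0 t ht x
      have h2 := hρ0 t ht x
      have h3 := hθ0 t ht x
      simp only [sigm, sub_sub_cancel]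
      positivity)
    (fun x => by
      have h1 := hg0 t ht x
      have h2 := hρ0 t ht x
      have h3 := hθ0 t ht x
      have h4 := hg1 t ht x
      have h5 := (hbd t ht x).2.2.1
      have h6 := (hbd t ht x).2.2.2
      simp only [sigm, sub_sub_cancel]
      rw [hPdef]
      gcongr)
  have z0 : (0:ℝ) ∈ Icc (0:ℝ) T := ⟨le_rfl, hT.le⟩
  have key := ode_est (y := Yen μp μm c (sigm μp μm γp γm c ρ θ u)) (K := Kin ρ u)
    (w := fun t => ∫ x in (0:ℝ)..1, pdx (sigm μp μm γp γm c ρ θ u) t x ^ 2)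
    (g := fun t => (⨆ x : Icc (0:ℝ) 1, |pdx u t x.1|) ^ 2)
    (A := A) (b := b) (r := 2 * ρbar) (D := 8 * M / m ^ 2) (e := 4 / m ^ 2)
    (Y0 := |S0| / (2 * m)) (E0 := |E0|) hT hA0.le hb0.le (by positivity) (by positivity)
    (by positivity)
    (fun t ht => yen_deriv ⟨hμp, hμm⟩ ⟨hkp, hkm⟩ hc hr hθ hu heq ht (hc01 t ht) (hρ0 t ht))
    (fun t ht => kin_deriv ⟨hkp, hkm⟩ hc hr hθ hu heq ht (hc01 t ht) (hρ0 t ht))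
    (fun t ht => (est t ht).1)
    (fun t ht => intervalIntegral.integral_nonneg zero_le_one fun x _ => by
      have := hρ0 t ht x
      positivity)
    (fun t ht => intervalIntegral.integral_nonneg zero_le_one fun x _ => sq_nonneg _)
    (fun t ht => by
      have h := (est t ht).2.1
      have h2 : 0 ≤ 2 * P ^ 2 / m ^ 2 := by positivity
      unfold Yen
      rw [hbdef]
      linarith)
    (fun t ht => by
      have h := (est t ht).2.2.1
      rw [← hAdef] at h
      exact h)
    (fun t ht => by
      have h := (est t ht).2.2.2.2.1
      have h2 : 0 ≤ P ^ 2 / (2 * m) := by positivity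
      refine h.trans ?_
      unfold Yen
      rw [hbdef, add_div, add_div]
      have e1 : ∀ y : ℝ, 8 * M * y / m ^ 2 = 8 * M / m ^ 2 * y := fun y => by ring
      have e2 : ∀ y : ℝ, 4 * y / m ^ 2 = 4 / m ^ 2 * y := fun y => by ring
      rw [e1, e2]
      linarith)
    (by
      have h := (est 0 z0).2.2.2.2.2
      refine h.trans ?_
      rw [hS]
      gcongr
      exact le_abs_self S0)
    (by
      refine le_trans ?_ (le_abs_self E0)
      rw [← hE]
      have cρ := hr.cx 0
      have cu := hu.cx 0
      have cθ := hθ.cx 0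
      have ck := (hc.affc kp km).cx 0
      refine intervalIntegral.integral_mono_on zero_le_one
        (Continuous.intervalIntegrable (by fun_prop) _ _)
        (Continuous.intervalIntegrable (by unfold Etot; fun_prop) _ _) fun x _ => ?_
      have h1 := hρ0 0 z0 x
      have h2 := hθ0 0 z0 x
      have h3 := hkmin.trans_le (hkpos 0 z0 x)
      have h4 : 0 ≤ ρ 0 x * (affc kp km (c 0 x) * θ 0 x) := by positivity
      unfold Etot
      linarith)
  rw [← hYdef] at key
  refine ⟨fun t ht => ?_, key.2⟩
  have h1 := (est t ht).2.2.2.1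
  have h2 := key.1 t ht
  unfold Yen at h2
  refine h1.trans ?_
  gcongr
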